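/- Let n ≥ 2, let U ⊂ ℝⁿ⁺¹ be a bounded open set whose closure does not contain 0, let W : ℝⁿ⁺¹ → ℝⁿ⁺¹ be C², let q : ℝⁿ⁺¹ → ℂ be bounded and measurable, and let ε > 0. Then there exists C > 0 such that for every h ∈ (0,1] and every w ∈ C_c^∞(U; ℂ), the difference between the magnetic and the free conjugated operators satisfies ‖L_{φ,W,q,ε} w − L_{φ,0,0,ε} w‖_{H⁻¹_h(U)} ≤ C·h·‖w‖_{L²(U)}, where L_{φ,0,0,ε} is the operator with W ≡ 0 and q ≡ 0, i.e. L_{φ,0,0,ε}w = h²·e^{φ/h + φ²/(2ε)}·(−Δ)(e^{−φ/h − φ²/(2ε)} w). -/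

import Mathlib

open MeasureTheory Complex Set

noncomputable section

/-- Euclidean space `ℝ^d`. -/
abbrev Euc (d : ℕ) := EuclideanSpace ℝ (Fin d)

/-- Partial derivative in the `j`-th coordinate direction. -/
def pd {d : ℕ} {F : Type*} [NormedAddCommGroup F] [NormedSpace ℝ F]
    (j : Fin d) (u : Euc d → F) : Euc d → F :=
  fun x => fderiv ℝ u x (EuclideanSpace.single j 1)

/-- The magnetic Schrödinger operator
`L_{W,q} u = -Δu - 2i⟨W,∇u⟩ - i (div W) u + (‖W‖² + q) u`. -/
def magSchrodinger {d : ℕ} (W : Euc d → Euc d) (q : Euc d → ℂ) (u : Euc d → ℂ) :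
    Euc d → ℂ :=
  fun x =>
    -(∑ j, pd j (pd j u) x)
    - 2 * Complex.I * ∑ j, ((W x j : ℝ) : ℂ) * pd j u x
    - Complex.I * (((∑ j, pd j (fun y => W y j) x) : ℝ) : ℂ) * u x
    + ((((‖W x‖ ^ 2 : ℝ)) : ℂ) + q x) * u x

/-- The logarithmic limiting Carleman weight `φ(x) = log ‖x‖`. -/
def carlWeight {d : ℕ} (x : Euc d) : ℝ := Real.log ‖x‖

/-- The conjugated operator `L_{φ,W,q} w = h² e^{φ/h} L_{W,q}(e^{-φ/h} w)`. -/
def conjOp {d : ℕ} (h : ℝ) (W : Euc d → Euc d) (q : Euc d → ℂ) (w : Euc d → ℂ) :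
    Euc d → ℂ :=
  fun x =>
    ((h : ℂ) ^ 2) * Complex.exp (((carlWeight x / h : ℝ) : ℂ)) *
      magSchrodinger W q
        (fun y => Complex.exp (((-(carlWeight y / h) : ℝ) : ℂ)) * w y) x

/-- The conjugated operator `L_{φ,W,q,ε} w = h² e^{φ/h + φ²/(2ε)} L_{W,q}(e^{-φ/h - φ²/(2ε)} w)`. -/
def conjOpEps {d : ℕ} (h ε : ℝ) (W : Euc d → Euc d) (q : Euc d → ℂ) (w : Euc d → ℂ) :
    Euc d → ℂ :=
  fun x =>
    ((h : ℂ) ^ 2) *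
      Complex.exp (((carlWeight x / h + (carlWeight x) ^ 2 / (2 * ε) : ℝ) : ℂ)) *
      magSchrodinger W q
        (fun y =>
          Complex.exp (((-(carlWeight y / h + (carlWeight y) ^ 2 / (2 * ε)) : ℝ) : ℂ)) * w y) x

/-- `w ∈ C_c^∞(U; ℂ)`. -/
def IsTest {d : ℕ} (U : Set (Euc d)) (w : Euc d → ℂ) : Prop :=
  ContDiff ℝ (⊤ : ℕ∞) w ∧ HasCompactSupport w ∧ tsupport w ⊆ U

/-- The `L²` norm on a set. -/
def L2normOn {d : ℕ} (U : Set (Euc d)) (w : Euc d → ℂ) : ℝ :=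
  Real.sqrt (∫ x in U, ‖w x‖ ^ 2)

/-- The semiclassical `H¹` norm on an open set. -/
def H1norm {d : ℕ} (h : ℝ) (U : Set (Euc d)) (ψ : Euc d → ℂ) : ℝ :=
  Real.sqrt ((∫ x in U, ‖ψ x‖ ^ 2) + h ^ 2 * ∫ x in U, ∑ j, ‖pd j ψ x‖ ^ 2)

/-- The semiclassical `H⁻¹` norm on an open set, defined by duality against
smooth compactly supported test functions. -/
def Hneg1norm {d : ℕ} (h : ℝ) (U : Set (Euc d)) (v : Euc d → ℂ) : ℝ :=
  sSup {r : ℝ | ∃ ψ : Euc d → ℂ, IsTest U ψ ∧ H1norm h U ψ ≤ 1 ∧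
    r = ‖∫ x in U, v x * (starRingEnd ℂ) (ψ x)‖}

section PartialDerivatives

variable {d : ℕ}

lemma HasFDerivAt.pd_eq {F : Type*} [NormedAddCommGroup F] [NormedSpace ℝ F]
    {u : Euc d → F} {u' : Euc d →L[ℝ] F} {x : Euc d} (hu : HasFDerivAt u u' x) (j : Fin d) :
    pd j u x = u' (EuclideanSpace.single j 1) := by
  rw [pd, hu.fderiv]

lemma pd_const {F : Type*} [NormedAddCommGroup F] [NormedSpace ℝ F] (c : F) (j : Fin d)
    (x : Euc d) : pd j (fun _ : Euc d => c) x = 0 := by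
  simp [pd]

lemma pd_mul {u v : Euc d → ℂ} {x : Euc d} (hu : DifferentiableAt ℝ u x)
    (hv : DifferentiableAt ℝ v x) (j : Fin d) :
    pd j (fun y => u y * v y) x = u x * pd j v x + v x * pd j u x := by
  refine ((hu.hasFDerivAt.mul hv.hasFDerivAt).pd_eq j).trans ?_
  simp [pd]

lemma pd_ofReal {f : Euc d → ℝ} {x : Euc d} (hf : DifferentiableAt ℝ f x) (j : Fin d) :
    pd j (fun y => ((f y : ℝ) : ℂ)) x = ((pd j f x : ℝ) : ℂ) := by
  refine ((Complex.ofRealCLM.hasFDerivAt.comp x hf.hasFDerivAt).pd_eq j).trans ?_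
  simp [pd]

lemma pd_conj {u : Euc d → ℂ} {x : Euc d} (hu : DifferentiableAt ℝ u x) (j : Fin d) :
    pd j (fun y => (starRingEnd ℂ) (u y)) x = (starRingEnd ℂ) (pd j u x) := by
  refine ((Complex.conjCLE.toContinuousLinearMap.hasFDerivAt.comp x hu.hasFDerivAt).pd_eq j).trans ?_
  simp [pd]

lemma pd_exp_neg_mul {f : Euc d → ℝ} {w : Euc d → ℂ} {x : Euc d}
    (hf : DifferentiableAt ℝ f x) (hw : DifferentiableAt ℝ w x) (j : Fin d) :
    pd j (fun y => Complex.exp (((-f y : ℝ) : ℂ)) * w y) x =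
      Complex.exp (((-f x : ℝ) : ℂ)) * (pd j w x - ((pd j f x : ℝ) : ℂ) * w x) := by
  have hE := (Complex.ofRealCLM.hasFDerivAt.comp x hf.neg.hasFDerivAt).cexp
  have hpd : pd j (fun y => Complex.exp (((-f y : ℝ) : ℂ))) x =
      -(Complex.exp (((-f x : ℝ) : ℂ)) * ((pd j f x : ℝ) : ℂ)) := by
    refine (hE.pd_eq j).trans ?_
    simp [pd, fderiv_neg]
  have hEd : DifferentiableAt ℝ (fun y => Complex.exp (((-f y : ℝ) : ℂ))) x :=
    hE.differentiableAt
  rw [pd_mul hEd hw, hpd]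
  ring

lemma ContDiff.continuous_pd {F : Type*} [NormedAddCommGroup F] [NormedSpace ℝ F]
    {u : Euc d → F} (hu : ContDiff ℝ 1 u) (j : Fin d) : Continuous (pd j u) :=
  (hu.continuous_fderiv one_ne_zero).clm_apply continuous_const

lemma HasCompactSupport.pd {F : Type*} [NormedAddCommGroup F] [NormedSpace ℝ F]
    {u : Euc d → F} (hu : HasCompactSupport u) (j : Fin d) : HasCompactSupport (pd j u) :=
  hu.fderiv_apply ℝ _

lemma pd_eq_zero_of_notMem_tsupport {F : Type*} [NormedAddCommGroup F] [NormedSpace ℝ F]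
    {u : Euc d → F} {x : Euc d} (hx : x ∉ tsupport u) (j : Fin d) : pd j u x = 0 := by
  have := image_eq_zero_of_notMem_tsupport (fun h => hx (tsupport_fderiv_subset ℝ h))
  simp [_root_.pd, this]

lemma integral_pd_eq_zero {u : Euc d → ℂ} (hu : ContDiff ℝ 1 u) (hc : HasCompactSupport u)
    (j : Fin d) : ∫ x, pd j u x = 0 := by
  have hd : Differentiable ℝ u := hu.differentiable one_ne_zero
  have := integral_smul_fderiv_eq_neg_fderiv_smul_of_integrable (μ := volume) (𝕜 := ℝ)
    (f := fun _ : Euc d => (1 : ℝ)) (g := u) (v := EuclideanSpace.single j 1)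
    (by simp)
    (by
      simp only [one_smul]
      exact (hu.continuous_pd j).integrable_of_hasCompactSupport (hc.pd j))
    (by simpa using hu.continuous.integrable_of_hasCompactSupport hc) (by fun_prop)
    (fun x _ => hd x)
  simpa [pd] using this

end PartialDerivatives

section ConjugatedOperator

variable {d : ℕ}

lemma contDiffOn_carlWeight : ContDiffOn ℝ 1 (carlWeight (d := d)) {0}ᶜ := by
  intro x hx
  exact ((contDiffAt_norm ℝ hx).log (norm_ne_zero_iff.2 hx)).contDiffWithinAt

lemma differentiableAt_carlWeight {x : Euc d} (hx : x ≠ 0) :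
    DifferentiableAt ℝ carlWeight x :=
  ((contDiffAt_norm ℝ hx).log (norm_ne_zero_iff.2 hx)).differentiableAt one_ne_zero

lemma continuousOn_pd_carlWeight (j : Fin d) :
    ContinuousOn (pd j (carlWeight (d := d))) {0}ᶜ :=
  (contDiffOn_carlWeight.continuousOn_fderiv_of_isOpen isOpen_compl_singleton le_rfl).clm_apply
    continuousOn_const

lemma pd_convexified_weight {h ε : ℝ} {x : Euc d} (hx : x ≠ 0) (j : Fin d) :
    pd j (fun y => carlWeight y / h + carlWeight y ^ 2 / (2 * ε)) x =
      (1 / h + carlWeight x / ε) * pd j carlWeight x := by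
  have hφ := (differentiableAt_carlWeight hx).hasFDerivAt
  have := (hφ.mul_const (1 / h)).add ((hφ.pow 2).mul_const (1 / (2 * ε)))
  simp only [mul_one_div] at this
  refine (HasFDerivAt.pd_eq this j).trans ?_
  simp [pd]
  ring

lemma conjOpEps_sub_free {h ε : ℝ} (W : Euc d → Euc d) (q : Euc d → ℂ) {w : Euc d → ℂ}
    {x : Euc d} (hx : x ≠ 0) (hw : DifferentiableAt ℝ w x) :
    conjOpEps h ε W q w x - conjOpEps h ε (fun _ => (0 : Euc d)) (fun _ => (0 : ℂ)) w x =
      (h : ℂ) ^ 2 *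
        (-(2 * Complex.I * ∑ j, ((W x j : ℝ) : ℂ) *
            (pd j w x - (((1 / h + carlWeight x / ε) * pd j carlWeight x : ℝ) : ℂ) * w x))
          - Complex.I * (((∑ j, pd j (fun y => W y j) x) : ℝ) : ℂ) * w x
          + ((((‖W x‖ ^ 2 : ℝ)) : ℂ) + q x) * w x) := by
  have hf : DifferentiableAt ℝ
      (fun y : Euc d => carlWeight y / h + carlWeight y ^ 2 / (2 * ε)) x := by
    have hφ := differentiableAt_carlWeight hx
    simp only [div_eq_mul_inv]
    fun_prop
  have hexp : Complex.exp (((carlWeight x / h + carlWeight x ^ 2 / (2 * ε) : ℝ) : ℂ)) *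
      Complex.exp (((-(carlWeight x / h + carlWeight x ^ 2 / (2 * ε)) : ℝ) : ℂ)) = 1 := by
    rw [← Complex.exp_add, ← Complex.ofReal_add, add_neg_cancel, Complex.ofReal_zero,
      Complex.exp_zero]
  simp only [conjOpEps, magSchrodinger, pd_exp_neg_mul hf hw, pd_convexified_weight hx,
    PiLp.zero_apply, pd_const, norm_zero]
  simp only [mul_left_comm _ (Complex.exp _) (_ - _), ← Finset.mul_sum]
  simp only [Complex.ofReal_zero, Finset.sum_const_zero, zero_mul, mul_zero, sub_zero,
    ne_eq, OfNat.ofNat_ne_zero, not_false_eq_true, zero_pow, add_zero]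
  linear_combination (h : ℂ) ^ 2 *
        (-(2 * Complex.I * ∑ j, ((W x j : ℝ) : ℂ) *
            (pd j w x - (((1 / h + carlWeight x / ε) * pd j carlWeight x : ℝ) : ℂ) * w x))
          - Complex.I * (((∑ j, pd j (fun y => W y j) x) : ℝ) : ℂ) * w x
          + ((((‖W x‖ ^ 2 : ℝ)) : ℂ) + q x) * w x) * hexp

end ConjugatedOperator

lemma integral_norm_mul_norm_le_L2normOn {d : ℕ} {U : Set (Euc d)} {f g : Euc d → ℂ}
    (hf : Continuous f) (hfc : HasCompactSupport f) (hg : Continuous g)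
    (hgc : HasCompactSupport g) :
    ∫ x in U, ‖f x‖ * ‖g x‖ ≤ L2normOn U f * L2normOn U g := by
  have h2 : (2 : ENNReal) = ENNReal.ofReal 2 := by simp
  have := integral_mul_norm_le_Lp_mul_Lq (μ := volume.restrict U) (f := f) (g := g)
    Real.HolderConjugate.two_two
    ((hf.memLp_of_hasCompactSupport hfc).restrict U)
    ((hg.memLp_of_hasCompactSupport hgc).restrict U)
  simpa [L2normOn, Real.sqrt_eq_rpow] using this

section TestFunctions

variable {d : ℕ} {U : Set (Euc d)} {w ψ : Euc d → ℂ}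

lemma IsTest.contDiff (hw : IsTest U w) : ContDiff ℝ 1 w :=
  hw.1.of_le (by exact_mod_cast le_top)

lemma IsTest.differentiableAt (hw : IsTest U w) (x : Euc d) : DifferentiableAt ℝ w x :=
  hw.contDiff.differentiable one_ne_zero x

lemma L2normOn_le_H1norm (h : ℝ) : L2normOn U ψ ≤ H1norm h U ψ := by
  refine Real.sqrt_le_sqrt (le_add_of_nonneg_right ?_)
  exact mul_nonneg (sq_nonneg h) (integral_nonneg fun x => by positivity)

lemma IsTest.mul_L2normOn_pd_le_H1norm (hψ : IsTest U ψ) {h : ℝ} (hh : 0 ≤ h) (j : Fin d) :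
    h * L2normOn U (pd j ψ) ≤ H1norm h U ψ := by
  have hint (i : Fin d) : IntegrableOn (fun x => ‖pd i ψ x‖ ^ 2) U := by
    have hc : HasCompactSupport fun x => ‖pd i ψ x‖ ^ 2 :=
      (hψ.2.1.pd i).comp_left (g := fun z : ℂ => ‖z‖ ^ 2) (by simp)
    exact (((hψ.contDiff.continuous_pd i).norm.pow 2).integrable_of_hasCompactSupport
      hc).integrableOn
  have hsqrt : h * L2normOn U (pd j ψ) = Real.sqrt (h ^ 2 * ∫ x in U, ‖pd j ψ x‖ ^ 2) := by
    rw [Real.sqrt_mul (sq_nonneg h), Real.sqrt_sq hh, L2normOn]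
  rw [hsqrt, H1norm]
  refine Real.sqrt_le_sqrt (le_add_of_nonneg_of_le (integral_nonneg fun x => by positivity) ?_)
  refine mul_le_mul_of_nonneg_left ?_ (sq_nonneg h)
  refine integral_mono (hint j) (integrable_finsetSum _ fun i _ => hint i) fun x => ?_
  exact Finset.single_le_sum (f := fun i => ‖pd i ψ x‖ ^ 2) (fun i _ => by positivity)
    (Finset.mem_univ j)

lemma IsTest.integrable_norm_mul_norm (hw : IsTest U w) {g : Euc d → ℂ} (hg : Continuous g) :
    IntegrableOn (fun x => ‖w x‖ * ‖g x‖) U := by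
  refine (Continuous.integrable_of_hasCompactSupport
    (hw.contDiff.continuous.norm.mul hg.norm) ?_).integrableOn
  exact hw.2.1.norm.mul_right

lemma IsTest.integrableOn_norm_mul_semiclassical (hw : IsTest U w) (hψ : IsTest U ψ) (h : ℝ) :
    IntegrableOn (fun x => ‖w x‖ * (‖ψ x‖ + h * ∑ j, ‖pd j ψ x‖)) U := by
  refine (Continuous.integrable_of_hasCompactSupport (hw.contDiff.continuous.norm.mul
    (hψ.contDiff.continuous.norm.add (continuous_const.mul
      (continuous_finsetSum _ fun j _ => (hψ.contDiff.continuous_pd j).norm)))) ?_).integrableOn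
  exact hw.2.1.norm.mul_right

lemma IsTest.integral_norm_mul_semiclassical_le (hw : IsTest U w) (hψ : IsTest U ψ) {h : ℝ}
    (hh : 0 ≤ h) :
    ∫ x in U, ‖w x‖ * (‖ψ x‖ + h * ∑ j, ‖pd j ψ x‖) ≤
      (1 + d) * (L2normOn U w * H1norm h U ψ) := by
  have hsplit : (fun x => ‖w x‖ * (‖ψ x‖ + h * ∑ j, ‖pd j ψ x‖)) =
      fun x => ‖w x‖ * ‖ψ x‖ + ∑ j, h * (‖w x‖ * ‖pd j ψ x‖) := by
    funext x
    rw [mul_add, Finset.mul_sum, Finset.mul_sum]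
    congr 1
    exact Finset.sum_congr rfl fun j _ => by ring
  have hint (j : Fin d) : IntegrableOn (fun x => h * (‖w x‖ * ‖pd j ψ x‖)) U :=
    (hw.integrable_norm_mul_norm (hψ.contDiff.continuous_pd j)).const_mul h
  have hw0 : 0 ≤ L2normOn U w := Real.sqrt_nonneg _
  rw [hsplit, integral_add (hw.integrable_norm_mul_norm hψ.contDiff.continuous)
    (integrable_finsetSum _ fun j _ => hint j), integral_finsetSum _ fun j _ => hint j,
    add_mul, one_mul]
  refine add_le_add ?_ ?_
  · exact (integral_norm_mul_norm_le_L2normOn hw.contDiff.continuous hw.2.1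
      hψ.contDiff.continuous hψ.2.1).trans
        (mul_le_mul_of_nonneg_left (L2normOn_le_H1norm h) hw0)
  · refine (Finset.sum_le_card_nsmul Finset.univ _ (L2normOn U w * H1norm h U ψ)
      fun j _ => ?_).trans_eq (by simp)
    rw [integral_const_mul]
    calc h * ∫ x in U, ‖w x‖ * ‖pd j ψ x‖
        ≤ h * (L2normOn U w * L2normOn U (pd j ψ)) :=
          mul_le_mul_of_nonneg_left (integral_norm_mul_norm_le_L2normOn hw.contDiff.continuous
            hw.2.1 (hψ.contDiff.continuous_pd j) (hψ.2.1.pd j)) hh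
      _ = L2normOn U w * (h * L2normOn U (pd j ψ)) := by ring
      _ ≤ L2normOn U w * H1norm h U ψ :=
          mul_le_mul_of_nonneg_left (hψ.mul_L2normOn_pd_le_H1norm hh j) hw0

end TestFunctions

lemma norm_semiclassical_first_order_le {ι : Type*} [Fintype ι] {h K : ℝ} (hh0 : 0 ≤ h)
    (hh1 : h ≤ 1) {a g b : ι → ℝ} {D s : ℝ} {Q : ℂ} (hg : ∀ j, h * |g j| ≤ b j)
    (hK : 2 * ∑ j, |a j| * (1 + b j) + |D| + |s| + ‖Q‖ ≤ K) (p : ι → ℂ) (ω z : ℂ) :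
    ‖(h : ℂ) ^ 2 * (ω * ((2 * Complex.I * ∑ j, (a j : ℂ) * (g j : ℂ) + Complex.I * (D : ℂ)
        + ((s : ℂ) + Q)) * z + 2 * Complex.I * ∑ j, (a j : ℂ) * p j))‖ ≤
      h * K * (‖ω‖ * (‖z‖ + h * ∑ j, ‖p j‖)) := by
  have hb (j : ι) : 0 ≤ b j := (by positivity : 0 ≤ h * |g j|).trans (hg j)
  have hS1 : ∑ j, |a j| * (1 + b j) = ∑ j, |a j| + ∑ j, |a j| * b j := by
    simp only [mul_add, mul_one, Finset.sum_add_distrib]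
  have hA : 0 ≤ ∑ j, |a j| := by positivity
  have hB : 0 ≤ ∑ j, |a j| * b j := Finset.sum_nonneg fun j _ => mul_nonneg (abs_nonneg _) (hb j)
  have hag : h * ‖∑ j, (a j : ℂ) * (g j : ℂ)‖ ≤ ∑ j, |a j| * b j := by
    refine (mul_le_mul_of_nonneg_left (norm_sum_le _ _) hh0).trans ?_
    rw [Finset.mul_sum]
    refine Finset.sum_le_sum fun j _ => ?_
    rw [norm_mul, Complex.norm_real, Complex.norm_real, Real.norm_eq_abs, Real.norm_eq_abs,
      mul_left_comm]
    exact mul_le_mul_of_nonneg_left (hg j) (abs_nonneg _)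
  have hap : ‖∑ j, (a j : ℂ) * p j‖ ≤ (∑ j, |a j|) * ∑ j, ‖p j‖ := by
    refine (norm_sum_le _ _).trans ?_
    rw [Finset.mul_sum]
    refine Finset.sum_le_sum fun j _ => ?_
    rw [norm_mul, Complex.norm_real, Real.norm_eq_abs]
    exact mul_le_mul_of_nonneg_right
      (Finset.single_le_sum (f := fun i => |a i|) (fun i _ => abs_nonneg _) (Finset.mem_univ j))
      (norm_nonneg _)
  set G := ‖∑ j, (a j : ℂ) * (g j : ℂ)‖
  set P := ∑ j, ‖p j‖
  have hP : 0 ≤ P := by positivity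
  have hzero : ‖2 * Complex.I * ∑ j, (a j : ℂ) * (g j : ℂ) + Complex.I * (D : ℂ)
      + ((s : ℂ) + Q)‖ ≤ 2 * G + |D| + (|s| + ‖Q‖) := by
    refine (norm_add₃_le ..).trans (add_le_add (add_le_add ?_ ?_) ((norm_add_le _ _).trans ?_))
    · simp [G]
    · simp
    · simp
  have hfirst : ‖2 * Complex.I * ∑ j, (a j : ℂ) * p j‖ ≤ 2 * ((∑ j, |a j|) * P) := by
    simpa using hap
  have hzeroK : h * (2 * G + |D| + (|s| + ‖Q‖)) ≤ K := by
    have h1 : h * (|D| + |s| + ‖Q‖) ≤ |D| + |s| + ‖Q‖ :=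
      mul_le_of_le_one_left (by positivity) hh1
    linarith
  have hfirstK : 2 * ∑ j, |a j| ≤ K := by
    have : 0 ≤ |D| + |s| + ‖Q‖ := by positivity
    linarith
  rw [norm_mul, norm_mul, norm_pow, Complex.norm_real, Real.norm_of_nonneg hh0]
  calc h ^ 2 * (‖ω‖ * _)
      ≤ h ^ 2 * (‖ω‖ * ((2 * G + |D| + (|s| + ‖Q‖)) * ‖z‖ + 2 * ((∑ j, |a j|) * P))) := by
        gcongr
        refine (norm_add_le _ _).trans (add_le_add ?_ hfirst)
        rw [norm_mul]
        gcongr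
    _ = h * ‖ω‖ * (h * (2 * G + |D| + (|s| + ‖Q‖)) * ‖z‖ + 2 * (∑ j, |a j|) * (h * P)) := by
        ring
    _ ≤ h * ‖ω‖ * (K * ‖z‖ + K * (h * P)) := by gcongr
    _ = h * K * (‖ω‖ * (‖z‖ + h * P)) := by ring

lemma conjOpEps_sub_free_mul_conj {d : ℕ} {h ε : ℝ} {W : Euc d → Euc d} (q : Euc d → ℂ)
    {w ψ : Euc d → ℂ} {x : Euc d} (hx : x ≠ 0) (hW : ∀ j, DifferentiableAt ℝ (fun y => W y j) x)
    (hw : DifferentiableAt ℝ w x) (hψ : DifferentiableAt ℝ ψ x) :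
    (conjOpEps h ε W q w x - conjOpEps h ε (fun _ => (0 : Euc d)) (fun _ => (0 : ℂ)) w x) *
        (starRingEnd ℂ) (ψ x) +
      2 * Complex.I * (h : ℂ) ^ 2 * ∑ j, pd j (fun y => ((W y j : ℝ) : ℂ) *
        (w y * (starRingEnd ℂ) (ψ y))) x =
      (h : ℂ) ^ 2 * (w x * ((2 * Complex.I * ∑ j, ((W x j : ℝ) : ℂ) *
          (((1 / h + carlWeight x / ε) * pd j carlWeight x : ℝ) : ℂ)
        + Complex.I * (((∑ j, pd j (fun y => W y j) x) : ℝ) : ℂ)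
        + ((((‖W x‖ ^ 2 : ℝ)) : ℂ) + q x)) * (starRingEnd ℂ) (ψ x)
        + 2 * Complex.I * ∑ j, ((W x j : ℝ) : ℂ) * (starRingEnd ℂ) (pd j ψ x))) := by
  have hψc : DifferentiableAt ℝ (fun y => (starRingEnd ℂ) (ψ y)) x :=
    (Complex.conjCLE.toContinuousLinearMap.hasFDerivAt.comp x hψ.hasFDerivAt).differentiableAt
  have hWc (j : Fin d) : DifferentiableAt ℝ (fun y => ((W y j : ℝ) : ℂ)) x :=
    (Complex.ofRealCLM.hasFDerivAt.comp x (hW j).hasFDerivAt).differentiableAt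
  have hF (j : Fin d) : pd j (fun y => ((W y j : ℝ) : ℂ) * (w y * (starRingEnd ℂ) (ψ y))) x =
      w x * (((W x j : ℝ) : ℂ) * (starRingEnd ℂ) (pd j ψ x)) +
        (starRingEnd ℂ) (ψ x) * (((W x j : ℝ) : ℂ) * pd j w x) +
        w x * (starRingEnd ℂ) (ψ x) * ((pd j (fun y => W y j) x : ℝ) : ℂ) := by
    rw [pd_mul (v := fun y => w y * (starRingEnd ℂ) (ψ y)) (hWc j) (hw.mul hψc), pd_mul hw hψc, pd_conj hψ, pd_ofReal (hW j)]
    ring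
  rw [conjOpEps_sub_free W q hx hw]
  simp only [hF, mul_sub, Finset.sum_add_distrib, Finset.sum_sub_distrib, ← Finset.mul_sum,
    Complex.ofReal_sum]
  simp only [← mul_assoc, ← Finset.sum_mul]
  ring

lemma exists_magnetic_coefficient_bound {d : ℕ} {S : Set (Euc d)} (hS : IsCompact S)
    (hS0 : (0 : Euc d) ∉ S) {W : Euc d → Euc d} (hW : ContDiff ℝ 1 W) (ε M : ℝ) :
    ∃ K > 0, ∀ x ∈ S, 2 * ∑ j, |W x j| * (1 + (1 + |carlWeight x| / ε) * |pd j carlWeight x|)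
      + |∑ j, pd j (fun y => W y j) x| + |‖W x‖ ^ 2| + M ≤ K := by
  have hsub : S ⊆ {0}ᶜ := fun x hx h0 => hS0 (h0 ▸ hx)
  have hWj (j : Fin d) : ContDiff ℝ 1 (fun y => W y j) := contDiff_euclidean.1 hW j
  have hcont : ContinuousOn (fun x => 2 * ∑ j, |W x j| *
      (1 + (1 + |carlWeight x| / ε) * |pd j carlWeight x|)
      + |∑ j, pd j (fun y => W y j) x| + |‖W x‖ ^ 2| + M) S := by
    have hφ : ContinuousOn (carlWeight (d := d)) S := contDiffOn_carlWeight.continuousOn.mono hsub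
    have hdφ (j : Fin d) := (continuousOn_pd_carlWeight j).mono hsub
    have hWc := hW.continuous
    have hWjc (j : Fin d) : Continuous (fun y => W y j) := (hWj j).continuous
    have hdW (j : Fin d) := (hWj j).continuous_pd j
    fun_prop
  obtain ⟨K, hK⟩ := hS.bddAbove_image hcont
  exact ⟨max K 1, by positivity, fun x hx => le_max_of_le_left (hK (mem_image_of_mem _ hx))⟩

lemma norm_integral_magnetic_difference_le {d : ℕ} {U : Set (Euc d)} (hU : MeasurableSet U)
    (hU0 : (0 : Euc d) ∉ U) {W : Euc d → Euc d} (hW : ContDiff ℝ 1 W) {q : Euc d → ℂ}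
    {h ε K M : ℝ} (hh0 : 0 < h) (hh1 : h ≤ 1) (hε : 0 < ε) (hq : ∀ x, ‖q x‖ ≤ M)
    (hK : ∀ x ∈ U, 2 * ∑ j, |W x j| * (1 + (1 + |carlWeight x| / ε) * |pd j carlWeight x|)
      + |∑ j, pd j (fun y => W y j) x| + |‖W x‖ ^ 2| + M ≤ K)
    {w ψ : Euc d → ℂ} (hw : IsTest U w) (hψ : IsTest U ψ) :
    ‖∫ x in U, (conjOpEps h ε W q w x -
        conjOpEps h ε (fun _ => (0 : Euc d)) (fun _ => (0 : ℂ)) w x) * (starRingEnd ℂ) (ψ x)‖ ≤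
      ∫ x in U, h * K * (‖w x‖ * (‖ψ x‖ + h * ∑ j, ‖pd j ψ x‖)) := by
  set D : Euc d → ℂ := fun x => (conjOpEps h ε W q w x -
        conjOpEps h ε (fun _ => (0 : Euc d)) (fun _ => (0 : ℂ)) w x) * (starRingEnd ℂ) (ψ x)
    with hD
  have hWj (j : Fin d) : ContDiff ℝ 1 (fun y => W y j) := contDiff_euclidean.1 hW j
  set F : Fin d → Euc d → ℂ := fun j y => ((W y j : ℝ) : ℂ) * (w y * (starRingEnd ℂ) (ψ y))
    with hF
  have hFc (j : Fin d) : ContDiff ℝ 1 (F j) :=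
    (Complex.ofRealCLM.contDiff.comp (hWj j)).mul
      (hw.contDiff.mul (Complex.conjCLE.toContinuousLinearMap.contDiff.comp hψ.contDiff))
  have hFs (j : Fin d) : HasCompactSupport (F j) := (hw.2.1.mul_right).mul_left
  have hFint (j : Fin d) : Integrable (pd j (F j)) :=
    ((hFc j).continuous_pd j).integrable_of_hasCompactSupport ((hFs j).pd j)
  have hFU (j : Fin d) : ∫ x in U, pd j (F j) x = 0 := by
    rw [setIntegral_eq_integral_of_forall_compl_eq_zero, integral_pd_eq_zero (hFc j) (hFs j)]
    intro x hx
    refine pd_eq_zero_of_notMem_tsupport (fun hxF => hx (hw.2.2 ?_)) j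
    refine closure_mono (fun y hy => ?_) hxF
    exact left_ne_zero_of_mul (right_ne_zero_of_mul hy)
  have hGint : IntegrableOn (fun x => 2 * Complex.I * (h : ℂ) ^ 2 * ∑ j, pd j (F j) x) U :=
    ((integrable_finsetSum _ fun j _ => hFint j).const_mul _).integrableOn
  have hG : ∫ x in U, 2 * Complex.I * (h : ℂ) ^ 2 * ∑ j, pd j (F j) x = 0 := by
    rw [integral_const_mul, integral_finsetSum _ fun j _ => (hFint j).integrableOn]
    simp [hFU]
  have hbound : ∀ x ∈ U, ‖D x + 2 * Complex.I * (h : ℂ) ^ 2 * ∑ j, pd j (F j) x‖ ≤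
      h * K * (‖w x‖ * (‖ψ x‖ + h * ∑ j, ‖pd j ψ x‖)) := by
    intro x hx
    have hx0 : x ≠ 0 := fun h0 => hU0 (h0 ▸ hx)
    rw [hD, hF]
    dsimp only
    rw [conjOpEps_sub_free_mul_conj q hx0 (fun j => (hWj j).differentiable one_ne_zero x)
      (hw.differentiableAt x) (hψ.differentiableAt x)]
    have hg (j : Fin d) : h * |(1 / h + carlWeight x / ε) * pd j carlWeight x| ≤
        (1 + |carlWeight x| / ε) * |pd j carlWeight x| := by
      rw [abs_mul, ← mul_assoc]
      refine mul_le_mul_of_nonneg_right ?_ (abs_nonneg _)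
      calc h * |1 / h + carlWeight x / ε|
          ≤ h * (|1 / h| + |carlWeight x / ε|) := by gcongr; exact abs_add_le _ _
        _ = 1 + h * (|carlWeight x| / ε) := by
            rw [abs_div, abs_div, abs_of_pos hh0, abs_of_pos hε, abs_one]
            field_simp
        _ ≤ 1 + |carlWeight x| / ε := by
            gcongr
            exact mul_le_of_le_one_left (by positivity) hh1
    have := norm_semiclassical_first_order_le hh0.le hh1 hg
      ((add_le_add_right (hq x) _).trans (hK x hx))
      (fun j => (starRingEnd ℂ) (pd j ψ x)) (w x) ((starRingEnd ℂ) (ψ x))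
    simpa only [RCLike.norm_conj] using this
  have hbint : IntegrableOn (fun x => h * K * (‖w x‖ * (‖ψ x‖ + h * ∑ j, ‖pd j ψ x‖))) U :=
    (hw.integrableOn_norm_mul_semiclassical hψ h).const_mul _
  have hle : ‖∫ x in U, (D x + 2 * Complex.I * (h : ℂ) ^ 2 * ∑ j, pd j (F j) x)‖ ≤
      ∫ x in U, h * K * (‖w x‖ * (‖ψ x‖ + h * ∑ j, ‖pd j ψ x‖)) :=
    norm_integral_le_of_norm_le hbint ((ae_restrict_iff' hU).2 (ae_of_all _ hbound))
  by_cases hDint : IntegrableOn D U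
  · rwa [integral_add hDint hGint, hG, add_zero] at hle
  · rw [integral_undef hDint, norm_zero]
    exact (norm_nonneg _).trans hle

/-- The magnetic terms of the conjugated operator are `O(h)` from `L²` to
semiclassical `H⁻¹`. -/
theorem stmt16 (n : ℕ) (hn : 2 ≤ n)
    (U : Set (Euc (n + 1))) (hUopen : IsOpen U) (hUbdd : Bornology.IsBounded U)
    (hU0 : (0 : Euc (n + 1)) ∉ closure U)
    (W : Euc (n + 1) → Euc (n + 1)) (hW : ContDiff ℝ 2 W)
    (q : Euc (n + 1) → ℂ) (hq_meas : Measurable q) (hq_bdd : ∃ M : ℝ, ∀ x, ‖q x‖ ≤ M)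
    (ε : ℝ) (hε : 0 < ε) :
    ∃ C > (0 : ℝ), ∀ h ∈ Set.Ioc (0 : ℝ) 1, ∀ w : Euc (n + 1) → ℂ, IsTest U w →
      Hneg1norm h U
          (fun x =>
            conjOpEps h ε W q w x -
              conjOpEps h ε (fun _ => (0 : Euc (n + 1))) (fun _ => (0 : ℂ)) w x) ≤
        C * h * L2normOn U w := by
  obtain ⟨M, hM⟩ := hq_bdd
  have hW1 : ContDiff ℝ 1 W := hW.of_le one_le_two
  obtain ⟨K, hK0, hK⟩ := exists_magnetic_coefficient_bound hUbdd.isCompact_closure hU0 hW1 ε M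
  refine ⟨K * (1 + (n + 1 : ℕ)), by positivity, fun h hh w hw => ?_⟩
  have hw0 : 0 ≤ L2normOn U w := Real.sqrt_nonneg _
  have hh0 : 0 < h := hh.1
  refine Real.sSup_le ?_ (by positivity)
  rintro r ⟨ψ, hψ, hψ1, rfl⟩
  refine (norm_integral_magnetic_difference_le hUopen.measurableSet
    (fun h0 => hU0 (subset_closure h0)) hW1 hh0 hh.2 hε hM
    (fun x hx => hK x (subset_closure hx)) hw hψ).trans ?_
  rw [integral_const_mul]
  calc h * K * ∫ x in U, ‖w x‖ * (‖ψ x‖ + h * ∑ j, ‖pd j ψ x‖)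
      ≤ h * K * ((1 + (n + 1 : ℕ)) * (L2normOn U w * H1norm h U ψ)) := by
        gcongr
        exact hw.integral_norm_mul_semiclassical_le hψ hh0.le
    _ ≤ h * K * ((1 + (n + 1 : ℕ)) * (L2normOn U w * 1)) := by gcongr
    _ = K * (1 + (n + 1 : ℕ)) * h * L2normOn U w := by ring
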